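/- Let U ⊆ ℝ² be an open set, φ : U → ℝ smooth with A(h) = ∂ₓh + φ ∂ᵤh, and suppose the curvature 𝒦 = −∂ᵤ(A(φ)) depends only on x, i.e. 𝒦(x,u) = k(x) on U for some smooth k : ℝ → ℝ. If δ : ℝ → ℝ is a twice differentiable solution of the Schrödinger-type equation δ''(x) + k(x)δ(x) = 0, then the function h(x,u) := δ(x) satisfies A(A(h)) + 𝒦·h = 0 on U, and consequently the 1-form 𝔖(h)·(−φ dx + du) is closed on U, where 𝔖(h) = A(h) − (∂ᵤφ)h. -/

import Mathlib

/-- Partial derivative with respect to the first variable `x`. -/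
noncomputable def pdx (f : ℝ → ℝ → ℝ) (x u : ℝ) : ℝ := deriv (fun t => f t u) x

/-- Partial derivative with respect to the second variable `u`. -/
noncomputable def pdu (f : ℝ → ℝ → ℝ) (x u : ℝ) : ℝ := deriv (fun t => f x t) u

/-- The vector field `A = ∂ₓ + φ ∂ᵤ` associated with the ODE `u' = φ(x,u)`. -/
noncomputable def Aop (φ h : ℝ → ℝ → ℝ) (x u : ℝ) : ℝ :=
  pdx h x u + φ x u * pdu h x u

/-- The operator `𝔖(h) = A(h) − (∂ᵤφ) h`. -/
noncomputable def Sfrak (φ h : ℝ → ℝ → ℝ) (x u : ℝ) : ℝ :=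
  Aop φ h x u - pdu φ x u * h x u

/-- The Gaussian curvature `𝒦 = −∂ᵤ(A(φ))` of the associated surface. -/
noncomputable def curvK (φ : ℝ → ℝ → ℝ) (x u : ℝ) : ℝ := -(pdu (Aop φ φ) x u)

theorem hasDerivAt_slice_fst {f : ℝ × ℝ → ℝ} {x u : ℝ} (hf : DifferentiableAt ℝ f (x, u)) :
    HasDerivAt (fun t => f (t, u)) (fderiv ℝ f (x, u) (1, 0)) x :=
  hf.hasFDerivAt.comp_hasDerivAt x ((hasDerivAt_id x).prodMk (hasDerivAt_const x u))

theorem hasDerivAt_slice_snd {f : ℝ × ℝ → ℝ} {x u : ℝ} (hf : DifferentiableAt ℝ f (x, u)) :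
    HasDerivAt (fun t => f (x, t)) (fderiv ℝ f (x, u) (0, 1)) u :=
  hf.hasFDerivAt.comp_hasDerivAt u ((hasDerivAt_const u x).prodMk (hasDerivAt_id u))

theorem pdx_eq_fderiv {f : ℝ → ℝ → ℝ} {p : ℝ × ℝ}
    (hf : DifferentiableAt ℝ (fun q : ℝ × ℝ => f q.1 q.2) p) :
    pdx f p.1 p.2 = fderiv ℝ (fun q : ℝ × ℝ => f q.1 q.2) p (1, 0) :=
  (hasDerivAt_slice_fst hf).deriv

theorem pdu_eq_fderiv {f : ℝ → ℝ → ℝ} {p : ℝ × ℝ}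
    (hf : DifferentiableAt ℝ (fun q : ℝ × ℝ => f q.1 q.2) p) :
    pdu f p.1 p.2 = fderiv ℝ (fun q : ℝ × ℝ => f q.1 q.2) p (0, 1) :=
  (hasDerivAt_slice_snd hf).deriv

theorem Aop_of_fst (φ : ℝ → ℝ → ℝ) (δ : ℝ → ℝ) :
    Aop φ (fun x _ => δ x) = fun x _ => deriv δ x := by
  funext x u
  simp [Aop, pdx, pdu]

/-- The first partial derivatives of a `C²` function are differentiable, and its mixed second
partial derivatives agree. -/
theorem hasDerivAt_pdx_pdu {U : Set (ℝ × ℝ)} (hU : IsOpen U) {φ : ℝ → ℝ → ℝ}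
    (hφ : ContDiffOn ℝ 2 (fun p : ℝ × ℝ => φ p.1 p.2) U) {x u : ℝ} (hp : (x, u) ∈ U) :
    ∃ a b : ℝ, HasDerivAt (fun t => pdx φ x t) a u ∧ HasDerivAt (fun t => pdu φ t u) a x ∧
      HasDerivAt (fun t => pdu φ x t) b u := by
  set F : ℝ × ℝ → ℝ := fun p => φ p.1 p.2 with hF
  have hC : ContDiffAt ℝ 2 F (x, u) := hφ.contDiffAt (hU.mem_nhds hp)
  have hFd : ∀ q ∈ U, DifferentiableAt ℝ F q := fun q hq =>
    (hφ.contDiffAt (hU.mem_nhds hq)).differentiableAt (by norm_num)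
  have hF' : DifferentiableAt ℝ (fderiv ℝ F) (x, u) :=
    (hC.fderiv_right (m := 1) (by norm_num)).differentiableAt (by norm_num)
  have happ (v w : ℝ × ℝ) :
      fderiv ℝ (fun q => fderiv ℝ F q v) (x, u) w = fderiv ℝ (fderiv ℝ F) (x, u) w v := by
    rw [fderiv_clm_apply hF' (differentiableAt_const v)]
    simp
  have hd (v : ℝ × ℝ) : DifferentiableAt ℝ (fun q => fderiv ℝ F q v) (x, u) :=
    hF'.clm_apply (differentiableAt_const v)
  have hsymm := (hC.isSymmSndFDerivAt (by simp)).eq (0, 1) (1, 0)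
  have hfst : ∀ᶠ t in nhds x, (t, u) ∈ U :=
    (Continuous.prodMk_left u).continuousAt.eventually_mem (hU.mem_nhds hp)
  have hsnd : ∀ᶠ t in nhds u, (x, t) ∈ U :=
    (Continuous.prodMk_right x).continuousAt.eventually_mem (hU.mem_nhds hp)
  refine ⟨fderiv ℝ (fderiv ℝ F) (x, u) (0, 1) (1, 0), fderiv ℝ (fderiv ℝ F) (x, u) (0, 1) (0, 1),
    ?_, ?_, ?_⟩
  · rw [← happ]
    exact (hasDerivAt_slice_snd (hd _)).congr_of_eventuallyEq
      (hsnd.mono fun t ht => pdx_eq_fderiv (hFd _ ht))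
  · rw [hsymm, ← happ]
    exact (hasDerivAt_slice_fst (hd _)).congr_of_eventuallyEq
      (hfst.mono fun t ht => pdu_eq_fderiv (hFd _ ht))
  · rw [← happ]
    exact (hasDerivAt_slice_snd (hd _)).congr_of_eventuallyEq
      (hsnd.mono fun t ht => pdu_eq_fderiv (hFd _ ht))

/-- If the curvature depends only on `x`, `𝒦(x,u) = k(x)`, and `δ` solves the
Schrödinger-type equation `δ'' + kδ = 0`, then `h(x,u) := δ(x)` satisfies
`A(A(h)) + 𝒦 h = 0` on `U`, and the 1-form `𝔖(h)(−φ dx + du)` is closed on `U`. -/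
theorem stmt9 (U : Set (ℝ × ℝ)) (hU : IsOpen U) (φ : ℝ → ℝ → ℝ)
    (hφ : ContDiffOn ℝ (⊤ : ℕ∞) (fun p : ℝ × ℝ => φ p.1 p.2) U)
    (k : ℝ → ℝ) (hk : ContDiff ℝ (⊤ : ℕ∞) k)
    (hcurv : ∀ p ∈ U, curvK φ p.1 p.2 = k p.1)
    (δ : ℝ → ℝ) (hδ : Differentiable ℝ δ) (hδ' : Differentiable ℝ (deriv δ))
    (hode : ∀ x, deriv (deriv δ) x + k x * δ x = 0) :
    (∀ p ∈ U, Aop φ (Aop φ (fun x _ => δ x)) p.1 p.2 +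
        curvK φ p.1 p.2 * δ p.1 = 0) ∧
      (∀ p ∈ U, pdu (fun x u => -φ x u * Sfrak φ (fun x _ => δ x) x u) p.1 p.2 =
        pdx (Sfrak φ (fun x _ => δ x)) p.1 p.2) := by
  refine ⟨?_, ?_⟩
  · intro p hp
    rw [Aop_of_fst, Aop_of_fst, hcurv p hp]
    exact hode p.1
  · rintro ⟨x, u⟩ hp
    have hφ2 : ContDiffOn ℝ 2 (fun p : ℝ × ℝ => φ p.1 p.2) U := contDiffOn_infty.1 hφ 2
    obtain ⟨a, b, hxu, hux, huu⟩ := hasDerivAt_pdx_pdu hU hφ2 hp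
    have hφu : HasDerivAt (fun t => φ x t) (pdu φ x u) u :=
      (hasDerivAt_slice_snd ((hφ2.contDiffAt (hU.mem_nhds hp)).differentiableAt
        (by norm_num))).differentiableAt.hasDerivAt
    have hK : -(a + (pdu φ x u * pdu φ x u + φ x u * b)) = k x := by
      rw [← hcurv _ hp]
      exact congrArg Neg.neg (hxu.add (hφu.mul huu)).deriv.symm
    have hS : Sfrak φ (fun x _ => δ x) = fun x u => deriv δ x - pdu φ x u * δ x := by
      funext x u
      simp only [Sfrak, Aop_of_fst]
    have hleft := (hφu.neg.mul ((huu.mul_const (δ x)).const_sub (deriv δ x))).deriv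
    have hright := ((hδ' x).hasDerivAt.sub (hux.mul (hδ x).hasDerivAt)).deriv
    rw [hS]
    refine hleft.trans (Eq.trans ?_ hright.symm)
    simp only [Pi.neg_apply]
    linear_combination -hode x - δ x * hK
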